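/- arXiv:2511.19800 — 3 statements merged into one kernel-verified Lean document; each statement's English description precedes it below -/
import Mathlib

section
/- Let p be a prime and let h be the 6×6 matrix over F_p that is block-diagonal with three 2×2 blocks all equal to [[1,1],[0,1]]. Then for every positive integer k with h^k ≠ identity, the fixed subspace {v in F_p^6 : h^k v = v} has codimension 3 in F_p^6; in particular, the only bireflection in the cyclic subgroup H = ⟨h⟩ of GL_6(F_p) is the identity, and hence H (which has order p > 1) is not generated by bireflections. -/
open MvPolynomial

/-- The action of a matrix `M` on the polynomial ring, by linear substitution of
the variables: the variable `Xᵢ` is sent to `∑ⱼ Mᵢⱼ Xⱼ`. -/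
noncomputable def matAct {ι : Type*} [Fintype ι] {K : Type*} [CommRing K]
    (M : Matrix ι ι K) : MvPolynomial ι K →ₐ[K] MvPolynomial ι K :=
  aeval fun i => ∑ j, C (M i j) * X j

/-- The invariant ring for a set `G` of matrices acting on the polynomial ring
by linear substitution of the variables. -/
noncomputable def invariants {ι K : Type*} [Fintype ι] [CommRing K]
    (G : Set (Matrix ι ι K)) : Subalgebra K (MvPolynomial ι K) :=
  ⨅ M ∈ G, AlgHom.equalizer (matAct M) (AlgHom.id K _)

/-- The depth of an ideal `I` of `A`: the supremum of lengths of regular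
sequences on `A` consisting of elements of `I`. -/
noncomputable def idealDepth (A : Type*) [CommRing A] (I : Ideal A) : ℕ∞ :=
  sSup {n : ℕ∞ | ∃ rs : List A, (∀ r ∈ rs, r ∈ I) ∧
    RingTheory.Sequence.IsRegular A rs ∧ (rs.length : ℕ∞) = n}

/-- The depth of a local ring: the depth of its maximal ideal. -/
noncomputable def localDepth (A : Type*) [CommRing A] [IsLocalRing A] : ℕ∞ :=
  idealDepth A (IsLocalRing.maximalIdeal A)

/-- A commutative ring is Cohen-Macaulay if every localization at a prime ideal
has depth equal to its Krull dimension. -/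
def IsCohenMacaulayRing (A : Type*) [CommRing A] : Prop :=
  ∀ (q : Ideal A) (_ : q.IsPrime),
    (localDepth (Localization.AtPrime q) : WithBot ℕ∞) =
      ringKrullDim (Localization.AtPrime q)

/-- A matrix is a bireflection if its fixed space has codimension at most 2. -/
def IsBireflection {ι K : Type*} [Fintype ι] [Field K] (M : Matrix ι ι K) : Prop :=
  Module.finrank K (ι → K) ≤
    Module.finrank K (LinearMap.ker (M.mulVecLin - LinearMap.id)) + 2

/-- The 6×6 block-diagonal matrix with three 2×2 blocks `[[1,a],[0,1]]`,
`[[1,b],[0,1]]`, `[[1,c],[0,1]]`. -/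
def blockMat (p : ℕ) (a b c : ZMod p) : Matrix (Fin 6) (Fin 6) (ZMod p) :=
  !![1, a, 0, 0, 0, 0;
     0, 1, 0, 0, 0, 0;
     0, 0, 1, b, 0, 0;
     0, 0, 0, 1, 0, 0;
     0, 0, 0, 0, 1, c;
     0, 0, 0, 0, 0, 1]

/-- The set of the matrices `blockMat p a b c` for `a, b, c ∈ 𝔽_p`. -/
def Gset (p : ℕ) : Set (Matrix (Fin 6) (Fin 6) (ZMod p)) :=
  {M | ∃ a b c : ZMod p, M = blockMat p a b c}

theorem blockMat_mul (p : ℕ) (a b c a' b' c' : ZMod p) :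
    blockMat p a b c * blockMat p a' b' c' = blockMat p (a + a') (b + b') (c + c') := by
  ext i j
  fin_cases i <;> fin_cases j <;>
    simp [blockMat, Matrix.mul_apply, Fin.sum_univ_succ, add_comm]

theorem blockMat_zero (p : ℕ) : blockMat p 0 0 0 = 1 := by
  ext i j
  fin_cases i <;> fin_cases j <;> simp [blockMat]

theorem blockMat_pow (p : ℕ) (a b c : ZMod p) (k : ℕ) :
    blockMat p a b c ^ k = blockMat p (k * a) (k * b) (k * c) := by
  induction k with
  | zero => simp [blockMat_zero]
  | succ k ih => rw [pow_succ, ih, blockMat_mul]; push_cast; ring_nf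

/-- The projection of `𝔽_p⁶` onto the coordinates with odd index. -/
def oddCoords (p : ℕ) : (Fin 6 → ZMod p) →ₗ[ZMod p] (Fin 3 → ZMod p) :=
  LinearMap.funLeft (ZMod p) (ZMod p) ![1, 3, 5]

theorem ker_blockMat_sub_id (p : ℕ) [Fact p.Prime] {a b c : ZMod p}
    (ha : a ≠ 0) (hb : b ≠ 0) (hc : c ≠ 0) :
    LinearMap.ker ((blockMat p a b c).mulVecLin - LinearMap.id) =
      LinearMap.ker (oddCoords p) := by
  ext v
  simp [blockMat, oddCoords, funext_iff, Fin.forall_fin_succ, dotProduct, Fin.sum_univ_succ,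
    Matrix.vecHead, Matrix.vecTail, LinearMap.funLeft_apply, ha, hb, hc]

theorem finrank_ker_blockMat_sub_id (p : ℕ) [Fact p.Prime] {a b c : ZMod p}
    (ha : a ≠ 0) (hb : b ≠ 0) (hc : c ≠ 0) :
    Module.finrank (ZMod p)
        (LinearMap.ker ((blockMat p a b c).mulVecLin - LinearMap.id)) + 3 =
      Module.finrank (ZMod p) (Fin 6 → ZMod p) := by
  have hinj : Function.Injective (![1, 3, 5] : Fin 3 → Fin 6) := by decide
  have hsurj : Function.Surjective (oddCoords p) :=
    LinearMap.funLeft_surjective_of_injective _ _ _ hinj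
  have h := (oddCoords p).finrank_range_add_finrank_ker
  rw [LinearMap.range_eq_top.mpr hsurj, finrank_top, Module.finrank_fin_fun] at h
  rw [ker_blockMat_sub_id p ha hb hc, ← h, add_comm]

theorem finrank_ker_blockMat_one_pow_sub_id (p : ℕ) [Fact p.Prime] {k : ℕ}
    (hk : blockMat p 1 1 1 ^ k ≠ 1) :
    Module.finrank (ZMod p)
        (LinearMap.ker ((blockMat p 1 1 1 ^ k).mulVecLin - LinearMap.id)) + 3 =
      Module.finrank (ZMod p) (Fin 6 → ZMod p) := by
  rw [blockMat_pow, mul_one] at hk ⊢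
  have hk0 : (k : ZMod p) ≠ 0 := fun h => hk (by rw [h, blockMat_zero])
  exact finrank_ker_blockMat_sub_id p hk0 hk0 hk0

theorem orderOf_blockMat_one (p : ℕ) [Fact p.Prime] : orderOf (blockMat p 1 1 1) = p := by
  refine orderOf_eq_prime ?_ fun h => ?_
  · rw [blockMat_pow, CharP.cast_eq_zero, zero_mul, blockMat_zero]
  · simpa [blockMat] using congrFun₂ h 0 1

/-- Let `h = blockMat p 1 1 1` be the block-diagonal matrix with three 2×2
blocks `[[1,1],[0,1]]`. For every positive integer `k` with `h^k ≠ 1`, the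
fixed subspace of `h^k` has codimension `3` in `𝔽_p⁶`; in particular the only
bireflection in the cyclic subgroup `H = ⟨h⟩` of `GL₆(𝔽_p)` is the identity,
and hence `H`, which has order `p > 1`, is not generated by bireflections. -/
theorem diag_block_no_bireflections (p : ℕ) [Fact p.Prime] :
    (∀ k : ℕ, 0 < k → (blockMat p 1 1 1) ^ k ≠ 1 →
      Module.finrank (ZMod p)
          (LinearMap.ker (((blockMat p 1 1 1) ^ k).mulVecLin - LinearMap.id)) + 3 =
        Module.finrank (ZMod p) (Fin 6 → ZMod p)) ∧
    ∀ g : GL (Fin 6) (ZMod p),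
      (g : Matrix (Fin 6) (Fin 6) (ZMod p)) = blockMat p 1 1 1 →
      (∀ u ∈ Subgroup.zpowers g,
        IsBireflection (u : Matrix (Fin 6) (Fin 6) (ZMod p)) → u = 1) ∧
      Nat.card (Subgroup.zpowers g) = p ∧ 1 < p ∧
      Subgroup.zpowers g ≠ Subgroup.closure
        {u : GL (Fin 6) (ZMod p) | u ∈ Subgroup.zpowers g ∧
          IsBireflection (u : Matrix (Fin 6) (Fin 6) (ZMod p))} := by
  refine ⟨fun k _ hk => finrank_ker_blockMat_one_pow_sub_id p hk, fun g hg => ?_⟩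
  have hp : 1 < p := (Fact.out : p.Prime).one_lt
  have hcard : Nat.card (Subgroup.zpowers g) = p := by
    rw [Nat.card_zpowers, ← orderOf_units, hg, orderOf_blockMat_one]
  have hbi : ∀ u ∈ Subgroup.zpowers g,
      IsBireflection (u : Matrix (Fin 6) (Fin 6) (ZMod p)) → u = 1 := by
    intro u hu hbu
    obtain ⟨k, rfl⟩ := mem_powers_iff_mem_zpowers.mpr hu
    by_contra hne
    have hne' : blockMat p 1 1 1 ^ k ≠ 1 := fun h =>
      hne (Units.ext (by simpa [hg] using h))
    have hfin := finrank_ker_blockMat_one_pow_sub_id p hne'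
    rw [← hg] at hfin
    simp only [IsBireflection, Units.val_pow_eq_pow_val] at hbu
    omega
  refine ⟨hbi, hcard, hp, fun h => ?_⟩
  have hbot : Subgroup.zpowers g = ⊥ := by
    rw [h, Subgroup.closure_eq_bot_iff]
    exact fun u hu => hbi u hu.1 hu.2
  rw [hbot, Subgroup.card_bot] at hcard
  omega
end

section
/- Let p be a prime, T = F_p[x_1, y_1, x_2, y_2, x_3, y_3], and let H be the cyclic subgroup of GL_6(F_p) generated by the block-diagonal matrix with three 2×2 blocks all equal to [[1,1],[0,1]], acting on T by linear substitution of the variables. Then the invariant ring S = T^H is a unique factorization domain. -/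
open MvPolynomial

section FixedSubring

variable {T : Type*} [CommRing T]

theorem fixed_of_mul_fixed [IsDomain T] (σ : T →+* T) {a b : T} (ha : a ≠ 0) (hσa : σ a = a)
    (hσab : σ (a * b) = a * b) : σ b = b := by
  rw [map_mul, hσa] at hσab
  exact mul_left_cancel₀ ha hσab

/-- The map induced by a ring endomorphism on classes of associated elements. -/
def associatesMap (σ : T →+* T) : Associates T → Associates T :=
  Quotient.map σ fun _ _ h => h.map σ

theorem mk_iterate (σ : T →+* T) (i : ℕ) (P : T) :
    Associates.mk (σ^[i] P) = (associatesMap σ)^[i] (Associates.mk P) := by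
  induction i with
  | zero => rfl
  | succ i ih => rw [Function.iterate_succ_apply', Function.iterate_succ_apply', ← ih]; rfl

theorem prime_iterate (σ : T →+* T) {n : ℕ} (hn : 0 < n) (hσ : σ^[n] = id) {P : T}
    (hP : Prime P) (i : ℕ) : Prime (σ^[i] P) := by
  have hinv : ∀ x, σ (σ^[n - 1] x) = x := fun x => by
    rw [← Function.iterate_succ_apply' σ (n - 1) x, Nat.succ_eq_add_one, Nat.sub_one_add_one hn.ne', hσ, id]
  have hinv' : ∀ x, σ^[n - 1] (σ x) = x := fun x => by
    rw [← Function.iterate_succ_apply σ (n - 1) x, Nat.succ_eq_add_one, Nat.sub_one_add_one hn.ne', hσ, id]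
  have hbij : Function.Bijective σ :=
    ⟨Function.LeftInverse.injective hinv', Function.RightInverse.surjective hinv⟩
  induction i with
  | zero => exact hP
  | succ i ih =>
    rw [Function.iterate_succ_apply']
    exact (MulEquiv.prime_iff (RingEquiv.ofBijective σ hbij)).mpr ih

/-- The product of the distinct conjugates, up to units, of a prime element `P` under an
endomorphism `σ` of finite order. -/
noncomputable def orbitProd (σ : T →+* T) (P : T) : T :=
  ∏ i ∈ Finset.range (Function.minimalPeriod (associatesMap σ) (Associates.mk P)),
    σ^[i] P

variable (σ : T →+* T) {n : ℕ}

theorem minimalPeriod_mk_pos (hn : 0 < n) (hσ : σ^[n] = id) (P : T) :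
    0 < Function.minimalPeriod (associatesMap σ) (Associates.mk P) := by
  apply Function.IsPeriodicPt.minimalPeriod_pos hn
  change (associatesMap σ)^[n] (Associates.mk P) = Associates.mk P
  rw [← mk_iterate, hσ, id]

theorem dvd_orbitProd (hn : 0 < n) (hσ : σ^[n] = id) (P : T) : P ∣ orbitProd σ P :=
  Finset.dvd_prod_of_mem (fun i => σ^[i] P)
    (Finset.mem_range.mpr (minimalPeriod_mk_pos σ hn hσ P))

theorem orbitProd_ne_zero [IsDomain T] (hn : 0 < n) (hσ : σ^[n] = id) {P : T} (hP : Prime P) :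
    orbitProd σ P ≠ 0 :=
  Finset.prod_ne_zero_iff.mpr fun i _ => (prime_iterate σ hn hσ hP i).ne_zero

theorem associated_map_orbitProd (hn : 0 < n) (hσ : σ^[n] = id) (P : T) :
    Associated (orbitProd σ P) (σ (orbitProd σ P)) := by
  have hk := minimalPeriod_mk_pos σ hn hσ P
  have hper := Function.iterate_minimalPeriod
    (f := associatesMap σ) (x := Associates.mk P)
  rw [← mk_iterate] at hper
  unfold orbitProd
  set k := Function.minimalPeriod (associatesMap σ) (Associates.mk P)
  obtain ⟨m, hm⟩ := Nat.exists_eq_succ_of_ne_zero hk.ne'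
  rw [map_prod]
  simp only [← Function.iterate_succ_apply' (σ : T → T)]
  rw [hm] at hper ⊢
  rw [Finset.prod_range_succ', Finset.prod_range_succ]
  exact (Associated.refl _).mul_mul (Associates.mk_eq_mk_iff_associated.mp hper).symm

theorem orbitProd_dvd [IsDomain T] [DecompositionMonoid T] (hn : 0 < n) (hσ : σ^[n] = id) {P a : T} (hP : Prime P)
    (ha : σ a = a) (hPa : P ∣ a) : orbitProd σ P ∣ a := by
  apply Finset.prod_dvd_of_isRelPrime
  · intro i hi j hj hij
    have hpi := prime_iterate σ hn hσ hP i
    have hpj := prime_iterate σ hn hσ hP j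
    refine (hpi.irreducible.isRelPrime_iff_not_dvd).mpr fun hdvd => hij ?_
    have hassoc := (hpi.dvd_prime_iff_associated hpj).mp hdvd
    rw [← Associates.mk_eq_mk_iff_associated, mk_iterate, mk_iterate] at hassoc
    exact Function.iterate_injOn_Iio_minimalPeriod (by simpa using hi) (by simpa using hj) hassoc
  · intro i hi
    clear hi
    induction i with
    | zero => exact hPa
    | succ i ih =>
      rw [Function.iterate_succ_apply', ← ha]
      exact map_dvd σ ih

/-- If `σ` is an endomorphism of finite order of a unique factorization domain and every element
fixed by `σ` up to a unit is fixed by `σ`, then the fixed subring of `σ` is a unique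
factorization domain. -/
theorem uniqueFactorizationMonoid_of_mem_iff_fixed {K : Type*} [CommRing K] [Algebra K T]
    [IsDomain T] [UniqueFactorizationMonoid T] (hn : 0 < n) (hσ : σ^[n] = id)
    (hunit : ∀ a, Associated a (σ a) → σ a = a)
    (S : Subalgebra K T) (hS : ∀ a, a ∈ S ↔ σ a = a) : UniqueFactorizationMonoid S := by
  have hdvd : ∀ a b : S, (a : T) ∣ b → a ∣ b := by
    rintro a b ⟨c, hc⟩
    by_cases ha : a = 0
    · subst ha
      have : b = 0 := Subtype.ext (by simpa using hc)
      rw [this]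
    · have ha' : (a : T) ≠ 0 := fun h => ha (Subtype.ext h)
      have hcS : σ c = c := fixed_of_mul_fixed σ ha' ((hS _).mp a.2) (by
        rw [← hc]; exact (hS _).mp b.2)
      exact ⟨⟨c, (hS c).mpr hcS⟩, Subtype.ext hc⟩
  have hisUnit : ∀ a : S, IsUnit (a : T) → IsUnit a := fun a ha =>
    isUnit_iff_dvd_one.mpr (hdvd a 1 (isUnit_iff_dvd_one.mp ha))
  have hwf : WfDvdMonoid S := by
    refine ⟨Subrelation.wf ?_ (InvImage.wf (fun a : S => (a : T))
      ((wellFounded_dvdNotUnit : WellFounded (DvdNotUnit (α := T)))))⟩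
    rintro a b ⟨ha, c, hc, rfl⟩
    exact ⟨fun h => ha (Subtype.ext h), c, fun h => hc (hisUnit c h), rfl⟩
  refine { toIsWellFounded := hwf, irreducible_iff_prime := ?_ }
  intro f
  refine ⟨fun hf => ?_, Prime.irreducible⟩
  obtain ⟨P, hPirr, hPf⟩ := WfDvdMonoid.exists_irreducible_factor
    (fun h => hf.not_isUnit (hisUnit f h)) (fun h => hf.ne_zero (Subtype.ext h))
  have hP : Prime P := hPirr.prime
  let N : S := ⟨orbitProd σ P, (hS _).mpr (hunit _ (associated_map_orbitProd σ hn hσ P))⟩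
  have hPN : P ∣ (N : T) := dvd_orbitProd σ hn hσ P
  have hNdvd : ∀ a : S, P ∣ (a : T) → N ∣ a := fun a h =>
    hdvd N a (orbitProd_dvd σ hn hσ hP ((hS _).mp a.2) h)
  have hNunit : ¬ IsUnit N := fun h =>
    hP.not_isUnit (isUnit_of_dvd_unit hPN (h.map S.subtype))
  have hN : Prime N := by
    refine ⟨fun h => orbitProd_ne_zero σ hn hσ hP (congrArg Subtype.val h), hNunit, ?_⟩
    intro a b hab
    have : P ∣ (a : T) * b := hPN.trans (map_dvd S.subtype hab)
    exact (hP.dvd_or_dvd this).imp (hNdvd a) (hNdvd b)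
  exact (hN.irreducible.associated_of_dvd hf (hNdvd f hPf)).prime hN

end FixedSubring

theorem matAct_matAct {ι K : Type*} [Fintype ι] [CommRing K] (M N : Matrix ι ι K)
    (a : MvPolynomial ι K) : matAct M (matAct N a) = matAct (N * M) a := by
  have h : (matAct M).comp (matAct N) = matAct (N * M) := by
    ext1 i
    simp only [matAct, AlgHom.comp_apply, aeval_X, map_sum, map_mul, Matrix.mul_apply,
      Finset.sum_mul, Finset.mul_sum, algHom_C, algebraMap_eq]
    rw [Finset.sum_comm]
    simp only [mul_assoc]
  exact DFunLike.congr_fun h a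

theorem matAct_one {ι K : Type*} [Fintype ι] [DecidableEq ι] [CommRing K] :
    matAct (1 : Matrix ι ι K) = AlgHom.id K _ := by
  ext1 i
  simp [matAct, Matrix.one_apply]

theorem matAct_iterate {ι K : Type*} [Fintype ι] [DecidableEq ι] [CommRing K]
    (M : Matrix ι ι K) (n : ℕ) (a : MvPolynomial ι K) :
    (matAct M)^[n] a = matAct (M ^ n) a := by
  induction n with
  | zero => simp [matAct_one]
  | succ n ih => rw [Function.iterate_succ_apply', ih, matAct_matAct, pow_succ]

theorem blockMat_one_pow (p n : ℕ) : blockMat p 1 1 1 ^ n = blockMat p n n n := by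
  induction n with
  | zero =>
    ext i j
    fin_cases i <;> fin_cases j <;> simp [blockMat]
  | succ n ih =>
    rw [pow_succ, ih]
    ext i j
    fin_cases i <;> fin_cases j <;>
      simp [blockMat, Matrix.mul_apply, Fin.sum_univ_succ, add_comm]

theorem mem_invariants_zpowers {ι K : Type*} [Fintype ι] [DecidableEq ι] [CommRing K]
    (g : GL ι K) (hg : IsOfFinOrder g) (a : MvPolynomial ι K) :
    a ∈ invariants ((fun u : GL ι K => (u : Matrix ι ι K)) '' (Subgroup.zpowers g)) ↔
      matAct (g : Matrix ι ι K) a = a := by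
  simp only [invariants, Algebra.mem_iInf, AlgHom.mem_equalizer, AlgHom.coe_id, id]
  refine ⟨fun h => h _ ⟨g, Subgroup.mem_zpowers g, rfl⟩, ?_⟩
  rintro h _ ⟨u, hu, rfl⟩
  obtain ⟨n, rfl⟩ := hg.mem_powers_iff_mem_zpowers.mpr hu
  change matAct ((g ^ n : GL ι K) : Matrix ι ι K) a = a
  rw [Units.val_pow_eq_pow_val, ← matAct_iterate]
  exact Function.iterate_fixed h n

/-- An algebra endomorphism of `p`-power order of a polynomial ring in characteristic `p` fixes
every element that it fixes up to a unit. -/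
theorem fixed_of_associated {ι K : Type*} [Field K] (p : ℕ) [Fact p.Prime] [CharP K p]
    (φ : MvPolynomial ι K →ₐ[K] MvPolynomial ι K) (hφ : φ^[p] = id)
    (a : MvPolynomial ι K) (ha : Associated a (φ a)) : φ a = a := by
  obtain ⟨u, hu⟩ := ha
  obtain ⟨c, -, hc⟩ := MvPolynomial.isUnit_iff_eq_C_of_isReduced.mp u.isUnit
  rw [hc] at hu
  have hiter : ∀ n : ℕ, φ^[n] a = a * C c ^ n := fun n => by
    induction n with
    | zero => simp
    | succ n ih =>
      rw [Function.iterate_succ_apply', ih, map_mul, map_pow, ← hu, algHom_C, algebraMap_eq]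
      ring
  by_cases h0 : a = 0
  · simp [h0]
  have h1 : (C c : MvPolynomial ι K) ^ p = 1 := by
    apply mul_left_cancel₀ h0
    rw [← hiter, hφ, id, mul_one]
  have h2 : (C c : MvPolynomial ι K) = 1 := by
    rw [← sub_eq_zero]
    refine pow_eq_zero_iff (n := p) (Fact.out : p.Prime).ne_zero |>.mp ?_
    rw [sub_pow_char, h1, one_pow, sub_self]
  rw [← hu, h2, mul_one]

/-- Let `H` be the cyclic subgroup of `GL₆(𝔽_p)` generated by the
block-diagonal matrix with three 2×2 blocks `[[1,1],[0,1]]`, acting on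
`T = 𝔽_p[x₁, y₁, x₂, y₂, x₃, y₃]` by linear substitution of the variables.
Then the invariant ring `S = T^H` is a unique factorization domain. -/
theorem invariants_H_ufd (p : ℕ) [Fact p.Prime]
    (g : GL (Fin 6) (ZMod p))
    (hg : (g : Matrix (Fin 6) (Fin 6) (ZMod p)) = blockMat p 1 1 1) :
    UniqueFactorizationMonoid
      ↥(invariants ((fun u : GL (Fin 6) (ZMod p) =>
        (u : Matrix (Fin 6) (Fin 6) (ZMod p))) '' (Subgroup.zpowers g))) := by
  have hpow : (g : Matrix (Fin 6) (Fin 6) (ZMod p)) ^ p = 1 := by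
    rw [hg, blockMat_one_pow, CharP.cast_eq_zero, ← Nat.cast_zero, ← blockMat_one_pow, pow_zero]
  have hfin : IsOfFinOrder g := isOfFinOrder_iff_pow_eq_one.mpr
    ⟨p, (Fact.out : p.Prime).pos, Units.ext (by simpa using hpow)⟩
  have hiter : (matAct (g : Matrix (Fin 6) (Fin 6) (ZMod p)))^[p] = id := by
    funext a
    rw [matAct_iterate, hpow, matAct_one, AlgHom.id_apply, id]
  exact uniqueFactorizationMonoid_of_mem_iff_fixed
    (matAct (g : Matrix (Fin 6) (Fin 6) (ZMod p))).toRingHom (Fact.out : p.Prime).pos hiter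
    (fixed_of_associated p _ hiter) _ (mem_invariants_zpowers g hfin)
end

section
/- Let p be a prime and d ≥ 3 an integer. Let h be the 2d × 2d matrix over F_p that is block-diagonal with d blocks all equal to [[1,1],[0,1]], let H = ⟨h⟩ ≤ GL_{2d}(F_p) act on the polynomial ring T = F_p[x_1, y_1, ..., x_d, y_d] by linear substitution of the variables, and set S = T^H. Then S does not satisfy Serre's condition S_3; that is, there exists a prime ideal q of S such that depth(S_q) < min(3, height q). -/
open MvPolynomial

set_option synthInstance.maxHeartbeats 1000000
set_option maxHeartbeats 1000000

/-- The block-diagonal matrix on `(𝔽_p^n)^{⊕d}` whose `i`-th diagonal block is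
`σ i`. -/
def blockDiag {d n : ℕ} {K : Type*} [CommRing K]
    (σ : Fin d → Matrix (Fin n) (Fin n) K) :
    Matrix (Fin d × Fin n) (Fin d × Fin n) K :=
  Matrix.of fun q r => if q.1 = r.1 then σ q.1 q.2 r.2 else 0

/-- The `2d × 2d` block-diagonal matrix over `𝔽_p` with `d` diagonal blocks
equal to `[[1,1],[0,1]]`; the variables of `T = 𝔽_p[x₁, y₁, …, x_d, y_d]` are
indexed by `Fin d × Fin 2`, with `xᵢ = X (i, 0)` and `yᵢ = X (i, 1)`. -/
def diagHMat (p d : ℕ) : Matrix (Fin d × Fin 2) (Fin d × Fin 2) (ZMod p) :=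
  blockDiag fun _ : Fin d => !![1, 1; 0, 1]

/-- The cyclic subgroup `H = ⟨h⟩` of `GL_{2d}(𝔽_p)` generated by `h = diagHMat
p d`, as a set of matrices (since `h` has finite order, it consists of the
natural powers of `h`). -/
def Hd (p d : ℕ) : Set (Matrix (Fin d × Fin 2) (Fin d × Fin 2) (ZMod p)) :=
  {N | ∃ k : ℕ, N = diagHMat p d ^ k}

namespace DiagonalInvariants

section RegularPairs

variable {A : Type*} [CommRing A]

/-- `b` is a nonzerodivisor modulo `a`. -/
def PairReg (a b : A) : Prop := ∀ x, a ∣ b * x → a ∣ x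

/-- `c` is a nonzerodivisor modulo `(a, b)`. -/
def TripleReg (a b c : A) : Prop :=
  ∀ x y z, c * x = a * y + b * z → ∃ y' z', x = a * y' + b * z'

theorem PairReg.pow_right {a b : A} (h : PairReg a b) (n : ℕ) : PairReg a (b ^ n) := by
  induction n with
  | zero => intro x hx; simpa using hx
  | succ n ih => exact fun x hx => h x (ih _ (by rwa [← mul_assoc, ← pow_succ]))

theorem PairReg.pow_left [IsDomain A] {a b : A} (ha : a ≠ 0) (h : PairReg a b) (n : ℕ) :
    PairReg (a ^ n) b := by
  induction n with
  | zero => intro x _; simp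
  | succ n ih =>
    intro x hx
    obtain ⟨x', rfl⟩ := ih x ((pow_dvd_pow a n.le_succ).trans hx)
    rw [pow_succ]
    refine mul_dvd_mul_left _ (h x' ?_)
    rw [pow_succ, mul_left_comm] at hx
    exact (mul_dvd_mul_iff_left (pow_ne_zero n ha)).1 hx

theorem PairReg.pow [IsDomain A] {a b : A} (ha : a ≠ 0) (h : PairReg a b) (m n : ℕ) :
    PairReg (a ^ m) (b ^ n) :=
  (h.pow_left ha m).pow_right n

theorem TripleReg.pow_left [IsDomain A] {a b c : A} (ha : a ≠ 0) (hab : PairReg a b)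
    (h : TripleReg a b c) (n : ℕ) : TripleReg (a ^ n) b c := by
  induction n with
  | zero => exact fun x _ _ _ => ⟨x, 0, by simp⟩
  | succ n ih =>
    intro x y z hx
    obtain ⟨x', w, rfl⟩ := h x (a ^ n * y) z (by rw [hx]; ring)
    obtain ⟨v, hv⟩ := hab (c * w - z) ⟨a ^ n * y - c * x', by linear_combination hx⟩
    have key : c * x' = a ^ n * y + b * (-v) := by
      refine mul_left_cancel₀ ha ?_
      linear_combination hx - b * hv
    obtain ⟨y', z', rfl⟩ := ih x' y (-v) key
    exact ⟨y', a * z' + w, by ring⟩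

theorem TripleReg.pow_mid {a b c : A} (hab : PairReg a b)
    (h : TripleReg a b c) (n : ℕ) : TripleReg a (b ^ n) c := by
  induction n with
  | zero => exact fun x _ _ _ => ⟨0, x, by simp⟩
  | succ n ih =>
    intro x y z hx
    obtain ⟨w, x', rfl⟩ := h x y (b ^ n * z) (by rw [hx]; ring)
    obtain ⟨v, hv⟩ := hab (b ^ n * z - c * x') ⟨c * w - y, by linear_combination -hx⟩
    obtain ⟨y', z', rfl⟩ := ih x' (-v) z (by linear_combination -hv)
    exact ⟨b * y' + w, z', by ring⟩

theorem TripleReg.pow_right {a b c : A} (h : TripleReg a b c) (n : ℕ) :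
    TripleReg a b (c ^ n) := by
  induction n with
  | zero => intro x y z hx; exact ⟨y, z, by simpa using hx⟩
  | succ n ih =>
    intro x y z hx
    obtain ⟨y', z', h'⟩ := ih (c * x) y z (by rw [← hx]; ring)
    exact h _ _ _ h'

theorem TripleReg.pow [IsDomain A] {a b c : A} (ha : a ≠ 0) (hab : PairReg a b)
    (h : TripleReg a b c) (l m n : ℕ) : TripleReg (a ^ l) (b ^ m) (c ^ n) :=
  ((h.pow_left ha hab l).pow_mid (hab.pow_left ha l) m).pow_right n

theorem PairReg.mul_unit {a b : A} (h : PairReg a b) {u v : A} (hu : IsUnit u) (hv : IsUnit v) :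
    PairReg (a * u) (b * v) := by
  intro x hx
  rw [hu.mul_right_dvd] at hx ⊢
  rw [mul_right_comm, hv.dvd_mul_right] at hx
  exact h x hx

theorem TripleReg.mul_unit {a b c : A} (h : TripleReg a b c) {u v w : A} (hu : IsUnit u)
    (hv : IsUnit v) (hw : IsUnit w) : TripleReg (a * u) (b * v) (c * w) := by
  intro x y z hx
  obtain ⟨u', hu'⟩ := hu.exists_right_inv
  obtain ⟨v', hv'⟩ := hv.exists_right_inv
  obtain ⟨w', hw'⟩ := hw.exists_right_inv
  obtain ⟨y', z', rfl⟩ := h x (u * y * w') (v * z * w')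
    (by linear_combination w' * hx - c * x * hw')
  exact ⟨u' * y', v' * z', by linear_combination -a * y' * hu' - b * z' * hv'⟩

theorem exists_of_isWeaklyRegular {a b c : A} {l : List A} [Nontrivial A]
    (h : RingTheory.Sequence.IsWeaklyRegular A (a :: b :: c :: l)) :
    a ≠ 0 ∧ PairReg a b ∧ TripleReg a b c := by
  refine ⟨?_, ?_, ?_⟩
  · rintro rfl
    have := ((RingTheory.Sequence.isWeaklyRegular_cons_iff A _ _).1 h).1
    exact one_ne_zero (this (by simp : (0 : A) • (1 : A) = (0 : A) • 0))
  · intro x hx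
    have h1 := h.regular_mod_prev 1 (by simp)
    have := h1.right_eq_zero_of_smul (x := Submodule.Quotient.mk x) (by
      rw [← Submodule.Quotient.mk_smul, Submodule.Quotient.mk_eq_zero]
      simpa [Ideal.mem_span_singleton] using hx)
    rw [Submodule.Quotient.mk_eq_zero] at this
    simpa [Ideal.mem_span_singleton] using this
  · intro x y z hx
    have h2 := h.regular_mod_prev 2 (by simp)
    have := h2.right_eq_zero_of_smul (x := Submodule.Quotient.mk x) (by
      rw [← Submodule.Quotient.mk_smul, Submodule.Quotient.mk_eq_zero]
      simp only [List.take_succ_cons, List.take_zero, Ideal.ofList_cons, Ideal.ofList_nil,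
        sup_bot_eq, smul_eq_mul, Ideal.mul_top, ← Ideal.span_union, Set.singleton_union,
        Ideal.mem_span_pair]
      exact ⟨y, z, by simp only [List.getElem_cons_succ, List.getElem_cons_zero]; rw [hx]; ring⟩)
    rw [Submodule.Quotient.mk_eq_zero] at this
    simp only [List.take_succ_cons, List.take_zero, Ideal.ofList_cons, Ideal.ofList_nil,
        sup_bot_eq, smul_eq_mul, Ideal.mul_top, ← Ideal.span_union, Set.singleton_union,
        Ideal.mem_span_pair] at this
    obtain ⟨y', z', h'⟩ := this
    exact ⟨y', z', by rw [← h']; ring⟩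

/-- A local ring of depth at least three contains a regular triple in its maximal ideal. -/
theorem exists_triple_of_three_le_localDepth [IsLocalRing A] (h : 3 ≤ localDepth A) :
    ∃ a ∈ IsLocalRing.maximalIdeal A, ∃ b ∈ IsLocalRing.maximalIdeal A,
      ∃ c ∈ IsLocalRing.maximalIdeal A, a ≠ 0 ∧ PairReg a b ∧ TripleReg a b c := by
  by_contra hcon
  have hle : localDepth A ≤ 2 := by
    refine sSup_le ?_
    rintro _ ⟨rs, hmem, hreg, rfl⟩
    match rs, hmem, hreg with
    | [], _, _ => simp
    | [_], _, _ => simp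
    | [_, _], _, _ => simp
    | a :: b :: c :: l, hmem, hreg =>
      exact (hcon ⟨a, hmem a (by simp), b, hmem b (by simp), c, hmem c (by simp),
        exists_of_isWeaklyRegular hreg.toIsWeaklyRegular⟩).elim
  exact absurd (h.trans hle) (by decide)

end RegularPairs

section Action

variable (p d : ℕ)

local notation "T" => MvPolynomial (Fin d × Fin 2) (ZMod p)
local notation "S" => invariants (Hd p d)
local notation "σ" => matAct (diagHMat p d)

theorem matAct_mul {ι K : Type*} [Fintype ι] [CommRing K] (M N : Matrix ι ι K) :
    matAct (M * N) = (matAct N).comp (matAct M) := by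
  ext1 i
  simp only [matAct, aeval_X, AlgHom.comp_apply, map_sum, map_mul, Matrix.mul_apply,
    algHom_C, algebraMap_eq, Finset.mul_sum, Finset.sum_mul]
  rw [Finset.sum_comm]
  simp only [mul_assoc]

theorem matAct_one {ι K : Type*} [Fintype ι] [DecidableEq ι] [CommRing K] :
    matAct (1 : Matrix ι ι K) = AlgHom.id K _ := by
  ext1 i
  simp [matAct, Matrix.one_apply]

theorem mem_invariants_iff {f : T} : f ∈ S ↔ σ f = f := by
  simp only [invariants, Algebra.mem_iInf, AlgHom.mem_equalizer, AlgHom.id_apply]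
  refine ⟨fun h => h _ ⟨1, (pow_one _).symm⟩, ?_⟩
  rintro h _ ⟨k, rfl⟩
  induction k with
  | zero => rw [pow_zero, matAct_one, AlgHom.id_apply]
  | succ k ih => rw [pow_succ, matAct_mul, AlgHom.comp_apply, ih, h]

theorem sigma_coe (f : S) : σ (f : T) = f := (mem_invariants_iff p d).1 f.2

theorem sigma_X_zero (i : Fin d) : σ (X (i, 0)) = X (i, 0) + X (i, 1) := by
  simp [matAct, diagHMat, blockDiag, Fintype.sum_prod_type, Fin.sum_univ_two, ite_add_ite]

theorem sigma_X_one (i : Fin d) : σ (X (i, 1)) = X (i, 1) := by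
  simp [matAct, diagHMat, blockDiag, Fintype.sum_prod_type, Fin.sum_univ_two]

/-- The invariant `yᵢ`. -/
noncomputable def yInv (i : Fin d) : S :=
  ⟨X (i, 1), (mem_invariants_iff p d).2 (sigma_X_one p d i)⟩

theorem artinSchreier_mem [Fact p.Prime] {g e : T} (hg : σ g = g + e) (he : σ e = e) :
    g ^ p - e ^ (p - 1) * g ∈ S := by
  have hp : e ^ (p - 1) * e = e ^ p := pow_sub_one_mul (Fact.out : p.Prime).ne_zero e
  rw [mem_invariants_iff]
  simp only [map_sub, map_pow, map_mul, hg, he, add_pow_char]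
  linear_combination -hp

theorem isIntegral_of_artinSchreier [Fact p.Prime] {R B : Type*} [CommRing R] [CommRing B]
    [Algebra R B] {x : B} (a b : R)
    (h : x ^ p - algebraMap R B a * x - algebraMap R B b = 0) : IsIntegral R x := by
  have hp : 1 < p := (Fact.out : p.Prime).one_lt
  refine ⟨Polynomial.X ^ p - (Polynomial.C a * Polynomial.X + Polynomial.C b), ?_, ?_⟩
  · refine Polynomial.monic_X_pow_sub (lt_of_le_of_lt Polynomial.degree_linear_le ?_)
    exact_mod_cast hp
  · simp only [Polynomial.eval₂_sub, Polynomial.eval₂_add, Polynomial.eval₂_mul,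
      Polynomial.eval₂_pow, Polynomial.eval₂_X, Polynomial.eval₂_C]
    linear_combination h

theorem isIntegral_invariants [Fact p.Prime] : Algebra.IsIntegral S T := by
  refine ⟨fun f => ?_⟩
  induction f using MvPolynomial.induction_on with
  | C a => exact isIntegral_algebraMap (R := S) (x := algebraMap (ZMod p) S a)
  | add f g hf hg => exact hf.add hg
  | mul_X f i hf =>
    refine hf.mul ?_
    obtain ⟨i, j⟩ := i
    fin_cases j
    · refine isIntegral_of_artinSchreier p (yInv p d i ^ (p - 1))
        ⟨_, artinSchreier_mem p d (sigma_X_zero p d i) (sigma_X_one p d i)⟩ ?_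
      exact sub_self _
    · exact isIntegral_algebraMap (R := S) (x := yInv p d i)

/-- The substitution setting `yᵢ = 0` for all `i < k`. -/
noncomputable def killY (k : ℕ) : T →ₐ[ZMod p] T :=
  aeval fun i => if i.2 = 1 ∧ i.1.val < k then 0 else X i

/-- The contraction to the invariant ring of the prime ideal `(yᵢ : i < k)`. -/
noncomputable def yPrime (k : ℕ) : Ideal S :=
  RingHom.ker ((killY p d k).comp (Subalgebra.val S))

instance [Fact p.Prime] (k : ℕ) : (yPrime p d k).IsPrime := by
  exact RingHom.ker_isPrime _

theorem mem_yPrime {k : ℕ} {f : S} : f ∈ yPrime p d k ↔ killY p d k (f : T) = 0 := Iff.rfl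

theorem killY_sigma (f : T) : killY p d d (σ f) = killY p d d f := by
  rw [← AlgHom.comp_apply]
  congr 1
  ext1 ⟨i, j⟩
  fin_cases j
  · simp only [AlgHom.comp_apply, Fin.zero_eta]
    rw [sigma_X_zero]; simp [killY]
  · simp only [AlgHom.comp_apply, Fin.mk_one]
    rw [sigma_X_one]

theorem killY_comp_killY {k l : ℕ} (h : k ≤ l) :
    (killY p d l).comp (killY p d k) = killY p d l := by
  ext1 i
  by_cases hi : i.2 = 1 ∧ i.1.val < k
  · simp [killY, hi, hi.2.trans_le h]
  · simp [killY, hi]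

theorem yPrime_lt [Fact p.Prime] {k : ℕ} (hk : k < d) : yPrime p d k < yPrime p d (k + 1) := by
  refine lt_of_le_of_ne (fun f hf => ?_) fun heq => ?_
  · rw [mem_yPrime] at hf ⊢
    rw [← killY_comp_killY p d k.le_succ, AlgHom.comp_apply, hf, map_zero]
  · have h1 : yInv p d ⟨k, hk⟩ ∈ yPrime p d (k + 1) := by simp [mem_yPrime, yInv, killY]
    rw [← heq, mem_yPrime] at h1
    simp [yInv, killY] at h1

theorem le_height_yPrime [Fact p.Prime] {k : ℕ} (hk : k ≤ d) :
    (k : ℕ∞) ≤ (yPrime p d k).height := by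
  induction k with
  | zero => simp
  | succ k ih =>
    push_cast
    exact (add_le_add_left (ih (by omega)) 1).trans
      (Ideal.height_add_one_le_of_lt_of_isPrime (yPrime_lt p d hk))

/-- The ideal of the invariant ring generated by the `yᵢ`. -/
noncomputable def yIdeal : Ideal S := Ideal.span (Set.range (yInv p d))

theorem exists_sigma_eq_add {f : S} (hf : f ∈ yIdeal p d) : ∃ g : T, σ g = g + f := by
  refine Submodule.span_induction ?_ ⟨0, by simp⟩ ?_ ?_ hf
  · rintro _ ⟨i, rfl⟩
    exact ⟨X (i, 0), sigma_X_zero p d i⟩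
  · rintro f f' - - ⟨g, hg⟩ ⟨g', hg'⟩
    exact ⟨g + g', by rw [map_add, hg, hg']; push_cast; ring⟩
  · rintro a f - ⟨g, hg⟩
    exact ⟨a * g, by rw [map_mul, hg, sigma_coe, smul_eq_mul]; push_cast; ring⟩

theorem yPrime_le_radical [Fact p.Prime] : yPrime p d d ≤ (yIdeal p d).radical := by
  intro f hf
  rw [Ideal.radical_eq_sInf, Ideal.mem_sInf]
  rintro P ⟨hP, hPp⟩
  have := isIntegral_invariants p d
  obtain ⟨Q, -, hQ, rfl⟩ := Ideal.exists_ideal_over_prime_of_isIntegral P (⊥ : Ideal T) (by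
    rw [← RingHom.ker_eq_comap_bot]
    exact fun x hx => by
      have : x = 0 := Subtype.ext hx
      simp [this])
  have hy : ∀ i : Fin d, (X (i, 1) : T) ∈ Q := fun i => hP (Ideal.subset_span ⟨i, rfl⟩)
  have hcomp : (Ideal.Quotient.mkₐ (ZMod p) Q).comp (killY p d d) =
      Ideal.Quotient.mkₐ (ZMod p) Q := by
    ext1 i
    by_cases hi : i.2 = 1 ∧ i.1.val < d
    · obtain ⟨i, j⟩ := i
      obtain rfl : j = 1 := hi.1
      simp [killY, Ideal.Quotient.eq_zero_iff_mem.2 (hy i)]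
    · simp only [AlgHom.comp_apply, killY, aeval_X, if_neg hi]
  have h := DFunLike.congr_fun hcomp (f : T)
  rw [AlgHom.comp_apply, (mem_yPrime p d).1 hf, map_zero] at h
  exact Ideal.mem_comap.2 (Ideal.Quotient.eq_zero_iff_mem.1 h.symm)

/-- In an integrally closed domain, a fraction `w = g / e` with `w ^ p - a w - b = 0` is
integral. -/
theorem dvd_of_artinSchreier [Fact p.Prime] {B : Type*} (K : Type*) [CommRing B] [IsDomain B]
    [IsIntegrallyClosed B] [Field K] [Algebra B K] [IsFractionRing B K] {g e a b : B} (he : e ≠ 0)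
    (h : g ^ p - (a * e ^ (p - 1)) * g = b * e ^ p) : e ∣ g := by
  have he' : algebraMap B K e ≠ 0 := by
    simpa using he
  have hp : algebraMap B K e ^ (p - 1) * algebraMap B K e = algebraMap B K e ^ p :=
    pow_sub_one_mul (Fact.out : p.Prime).ne_zero _
  have h' := congrArg (algebraMap B K) h
  simp only [map_sub, map_mul, map_pow] at h'
  have hfrac : IsIntegral B (algebraMap B K g / algebraMap B K e) := by
    refine isIntegral_of_artinSchreier p a b ?_
    rw [← mul_eq_zero_iff_right (pow_ne_zero p he'), div_pow, sub_mul, sub_mul,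
      div_mul_cancel₀ _ (pow_ne_zero p he'), ← h', ← hp]
    field_simp
    ring
  obtain ⟨w, hw⟩ := IsIntegrallyClosed.isIntegral_iff.1 hfrac
  refine ⟨w, IsFractionRing.injective B K ?_⟩
  rw [map_mul, hw, mul_div_cancel₀ _ he']

theorem not_tripleReg [Fact p.Prime] (A : Type*) [CommRing A] [Algebra S A]
    [IsLocalization.AtPrime A (yPrime p d d)] {f₁ f₂ f₃ : S} (h₁ : f₁ ∈ yIdeal p d)
    (h₂ : f₂ ∈ yIdeal p d) (h₃ : f₃ ∈ yIdeal p d) (hf : f₁ ≠ 0)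
    (hpair : PairReg (algebraMap S A (f₁ ^ p)) (algebraMap S A (f₂ ^ p))) :
    ¬ TripleReg (algebraMap S A f₁) (algebraMap S A f₂) (algebraMap S A f₃) := by
  classical
  intro htriple
  have hinj : Function.Injective (algebraMap S A) :=
    IsLocalization.injective A (yPrime p d d).primeCompl_le_nonZeroDivisors
  obtain ⟨g₁, hg₁⟩ := exists_sigma_eq_add p d h₁
  obtain ⟨g₂, hg₂⟩ := exists_sigma_eq_add p d h₂
  obtain ⟨g₃, hg₃⟩ := exists_sigma_eq_add p d h₃
  have mem (g g' : T) (f f' : S) (hg : σ g = g + f) (hg' : σ g' = g' + f') :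
      g * f' - g' * f ∈ S := by
    rw [mem_invariants_iff]
    simp only [map_sub, map_mul, hg, hg', sigma_coe]
    ring
  let u₁₂ : S := ⟨_, mem g₁ g₂ f₁ f₂ hg₁ hg₂⟩
  let u₁₃ : S := ⟨_, mem g₁ g₃ f₁ f₃ hg₁ hg₃⟩
  let u₂₃ : S := ⟨_, mem g₂ g₃ f₂ f₃ hg₂ hg₃⟩
  have hrel : f₃ * u₁₂ = f₁ * (-u₂₃) + f₂ * u₁₃ := by
    refine Subtype.ext ?_
    simp only [u₁₂, u₁₃, u₂₃]
    push_cast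
    ring
  obtain ⟨a', b', hab⟩ := htriple (algebraMap S A u₁₂) (algebraMap S A (-u₂₃))
    (algebraMap S A u₁₃) (by simp only [← map_mul, ← map_add, hrel])
  obtain ⟨s, hs⟩ := IsLocalization.exist_integer_multiples_of_finset
    (yPrime p d d).primeCompl ({a', b'} : Finset A)
  obtain ⟨a, ha⟩ := hs a' (by simp)
  obtain ⟨b, hb⟩ := hs b' (by simp)
  rw [Algebra.smul_def] at ha hb
  have hab' : (s : S) * u₁₂ = f₁ * a + f₂ * b := by
    apply hinj
    simp only [map_mul, map_add, ha, hb, hab]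
    ring
  have habT : (s : T) * (g₁ * f₂ - g₂ * f₁) = f₁ * a + f₂ * b := congrArg Subtype.val hab'
  have hG₁ : σ (s * g₁ - b) = (s * g₁ - b) + s * f₁ := by
    simp only [map_sub, map_mul, hg₁, sigma_coe]; ring
  have hG₂ : σ (s * g₂ + a) = (s * g₂ + a) + s * f₂ := by
    simp only [map_add, map_mul, hg₂, sigma_coe]; ring
  set G₁ : T := s * g₁ - b
  set G₂ : T := s * g₂ + a
  have hG : G₁ * f₂ = G₂ * f₁ := by simp only [G₁, G₂]; linear_combination habT
  have hfix (f : S) : σ ((s : T) * f) = s * f := by simp only [map_mul, sigma_coe]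
  have hp (e : T) : e ^ (p - 1) * e = e ^ p :=
    pow_sub_one_mul (Fact.out : p.Prime).ne_zero e
  let A₁ : S := ⟨_, artinSchreier_mem p d hG₁ (hfix f₁)⟩
  let A₂ : S := ⟨_, artinSchreier_mem p d hG₂ (hfix f₂)⟩
  have hA : f₂ ^ p * A₁ = f₁ ^ p * A₂ := by
    refine Subtype.ext ?_
    simp only [A₁, A₂]
    push_cast
    have e1 : G₁ ^ p * (f₂ : T) ^ p = G₂ ^ p * (f₁ : T) ^ p := by rw [← mul_pow, hG, mul_pow]
    rw [mul_pow, mul_pow]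
    have e2 := hp (f₁ : T)
    have e3 := hp (f₂ : T)
    linear_combination e1 - (s : T) ^ (p - 1) * (f₁ : T) ^ (p - 1) * (f₂ : T) ^ (p - 1) * hG
      + (s : T) ^ (p - 1) * (f₁ : T) ^ (p - 1) * G₁ * e3
      - (s : T) ^ (p - 1) * (f₂ : T) ^ (p - 1) * G₂ * e2
  obtain ⟨t', ht'⟩ := hpair (algebraMap S A A₁)
    ⟨algebraMap S A A₂, by simp only [← map_mul, hA]⟩
  obtain ⟨⟨t, r⟩, htr⟩ := IsLocalization.surj (yPrime p d d).primeCompl t'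
  have ht : (r : S) * A₁ = f₁ ^ p * t := by
    apply hinj
    rw [map_mul, map_mul, ht', ← htr]
    ring
  have htT : (r : T) * (G₁ ^ p - ((s : T) * f₁) ^ (p - 1) * G₁) = (f₁ : T) ^ p * t :=
    congrArg Subtype.val ht
  have hfT : (f₁ : T) ≠ 0 := fun h => hf (Subtype.ext h)
  obtain ⟨w, hw⟩ : (f₁ : T) ∣ r * G₁ := by
    refine dvd_of_artinSchreier p (FractionRing T) (a := ((r : T) * s) ^ (p - 1))
      (b := (r : T) ^ (p - 1) * t)
      hfT ?_
    rw [mul_pow] at htT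
    rw [mul_pow, mul_pow, ← hp (r : T)]
    linear_combination (r : T) ^ (p - 1) * htT
  have hσw := congrArg σ hw
  rw [map_mul, map_mul, sigma_coe, sigma_coe, hG₁, mul_add, hw] at hσw
  have hrs : (r : T) * s = σ w - w := by
    refine mul_left_cancel₀ hfT ?_
    linear_combination hσw
  have hmem : (r : S) * s ∈ yPrime p d d := by
    rw [mem_yPrime]
    push_cast
    rw [hrs, map_sub, killY_sigma, sub_self]
  exact (inferInstance : (yPrime p d d).IsPrime).mem_or_mem hmem |>.elim r.2 s.2

theorem localDepth_yPrime_lt [Fact p.Prime] (A : Type*) [CommRing A] [IsLocalRing A] [Algebra S A]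
    [IsLocalization.AtPrime A (yPrime p d d)] : localDepth A < 3 := by
  by_contra hdepth
  have : IsDomain A := IsLocalization.isDomain_of_atPrime A (yPrime p d d)
  obtain ⟨a, ha, b, hb, c, hc, ha0, hab, habc⟩ :=
    exists_triple_of_three_le_localDepth (not_lt.1 hdepth)
  have key (a : A) (ha : a ∈ IsLocalRing.maximalIdeal A) :
      ∃ f ∈ yIdeal p d, ∃ n, ∃ u : A, IsUnit u ∧ algebraMap S A f = a ^ n * u := by
    obtain ⟨f, s, rfl⟩ := IsLocalization.exists_mk'_eq (yPrime p d d).primeCompl a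
    have hf := (IsLocalization.AtPrime.mk'_mem_maximal_iff A (yPrime p d d) f s).1 ha
    obtain ⟨n, hn⟩ := yPrime_le_radical p d hf
    refine ⟨f ^ n, hn, n, algebraMap S A s ^ n, (IsLocalization.map_units A s).pow n, ?_⟩
    rw [← mul_pow, IsLocalization.mk'_spec, map_pow]
  obtain ⟨f₁, h₁, l, u, hu, e₁⟩ := key a ha
  obtain ⟨f₂, h₂, m, v, hv, e₂⟩ := key b hb
  obtain ⟨f₃, h₃, n, w, hw, e₃⟩ := key c hc
  refine not_tripleReg p d A h₁ h₂ h₃ ?_ ?_ ?_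
  · rintro rfl
    rw [map_zero] at e₁
    exact mul_ne_zero (pow_ne_zero l ha0) hu.ne_zero e₁.symm
  · rw [map_pow, map_pow, e₁, e₂, mul_pow, mul_pow, ← pow_mul, ← pow_mul]
    exact (hab.pow ha0 _ _).mul_unit (hu.pow p) (hv.pow p)
  · rw [e₁, e₂, e₃]
    exact (habc.pow ha0 hab l m n).mul_unit hu hv hw

end Action

end DiagonalInvariants

/-- Let `h` be the `2d × 2d` block-diagonal matrix over `𝔽_p` with `d` blocks
equal to `[[1,1],[0,1]]`, let `H = ⟨h⟩` act on `T = 𝔽_p[x₁, y₁, …, x_d, y_d]`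
by linear substitution, and `S = T^H`. Then `S` does not satisfy Serre's
condition `S₃`: it is not the case that for every prime ideal `q` of `S` one
has `depth S_q ≥ min 3 (height q)` (where `height q = dim S_q`); that is, there
is a prime `q` with `depth S_q < min 3 (height q)`. -/
theorem diagonal_invariants_not_S3 (p d : ℕ) [Fact p.Prime] (hd : 3 ≤ d) :
    ¬ ∀ (q : Ideal ↥(invariants (Hd p d))) [q.IsPrime],
      min (((3 : ℕ∞) : WithBot ℕ∞)) (ringKrullDim (Localization.AtPrime q)) ≤
        (localDepth (Localization.AtPrime q) : WithBot ℕ∞) := by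
  intro h
  have hlt := DiagonalInvariants.localDepth_yPrime_lt p d
    (Localization.AtPrime (DiagonalInvariants.yPrime p d d))
  refine absurd (h (DiagonalInvariants.yPrime p d d)) (not_le.2 ?_)
  rw [IsLocalization.AtPrime.ringKrullDim_eq_height (DiagonalInvariants.yPrime p d d)
    (Localization.AtPrime (DiagonalInvariants.yPrime p d d))]
  refine lt_min (by exact_mod_cast hlt) (lt_of_lt_of_le (b := ((3 : ℕ∞) : WithBot ℕ∞))
    (by exact_mod_cast hlt) ?_)
  have hheight := DiagonalInvariants.le_height_yPrime p d le_rfl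
  exact_mod_cast (Nat.cast_le.2 hd).trans hheight
end
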